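/- With the setup below, define m_1,…,m_N ∈ 𝕂ˣ by: for 1 ≤ k ≤ n−1 and 1 ≤ a ≤ n−k, m_{s_k+a} := z_{1+s_{n−a}} if k = 1, and m_{s_k+a} := z_{k+s_{n−k−a+1}} / z_{k−1+s_{n−k−a+1}} if k ≥ 2. Then the diagonal entries of b satisfy, for every 1 ≤ j ≤ n: b_{n+1−j, n+1−j} = d_{jj} · (∏_{k=1}^{j−1} m_{s_k+(j−k)}) / (∏_{r=1}^{n−j} m_{s_j+r}), where empty products equal 1. -/

import Mathlib

open Matrix

/-- `yMat n 𝕂 i z` is the n×n identity matrix except entry (i+1, i) (1-based) equals `z`. -/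
def yMat (n : ℕ) (𝕂 : Type*) [Field 𝕂] (i : ℕ) (z : 𝕂) :
    Matrix (Fin n) (Fin n) 𝕂 :=
  fun a b => if a = b then 1 else if (a : ℕ) = i ∧ (b : ℕ) + 1 = i then z else 0

/-- `xMat n 𝕂 i z` is the n×n identity matrix except entry (i, i+1) (1-based) equals `z`. -/
def xMat (n : ℕ) (𝕂 : Type*) [Field 𝕂] (i : ℕ) (z : 𝕂) :
    Matrix (Fin n) (Fin n) 𝕂 :=
  fun a b => if a = b then 1 else if (a : ℕ) + 1 = i ∧ (b : ℕ) = i then z else 0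

/-- `xNegMat n 𝕂 i z` is the identity except the 2×2 block in rows/cols i, i+1 (1-based)
equals [[z⁻¹, 0], [1, z]]. -/
noncomputable def xNegMat (n : ℕ) (𝕂 : Type*) [Field 𝕂] (i : ℕ) (z : 𝕂) :
    Matrix (Fin n) (Fin n) 𝕂 :=
  fun a b =>
    if (a : ℕ) + 1 = i ∧ (b : ℕ) + 1 = i then z⁻¹
    else if (a : ℕ) = i ∧ (b : ℕ) = i then z
    else if (a : ℕ) = i ∧ (b : ℕ) + 1 = i then 1
    else if a = b then 1 else 0

/-- The matrix w̄₀ with (i, n+1−i) entry (−1)^(n−i) (1-based) and other entries 0. -/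
def w0bar (n : ℕ) (𝕂 : Type*) [Field 𝕂] : Matrix (Fin n) (Fin n) 𝕂 :=
  fun a b => if (a : ℕ) + (b : ℕ) = n - 1 then (-1 : 𝕂) ^ (n - 1 - (a : ℕ)) else 0

/-- s_k = Σ_{j=1}^{k−1} (n−j). -/
def sIdx (n k : ℕ) : ℕ := ∑ j ∈ Finset.Icc 1 (k - 1), (n - j)

/-- The word 𝐢₀ = (1,2,…,n−1, 1,2,…,n−2, …, 1,2, 1). -/
def wordI0 (n : ℕ) : List ℕ :=
  (List.range (n - 1)).flatMap (fun k => (List.range (n - 1 - k)).map (· + 1))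

/-- The word 𝐢′₀ = (n−1,…,1, n−1,…,2, …, n−1,n−2, n−1). -/
def wordI0' (n : ℕ) : List ℕ :=
  (List.range (n - 1)).flatMap (fun k => (List.range (n - 1 - k)).map (fun a => n - 1 - a))

/-- The simple reflection s_i = (i, i+1) (1-based) as a permutation of `Fin n`. -/
def sPerm (n i : ℕ) : Equiv.Perm (Fin n) :=
  if h : 1 ≤ i ∧ i < n then Equiv.swap ⟨i - 1, by omega⟩ ⟨i, h.2⟩ else 1

/-- The longest element of S_n, k ↦ n+1−k (1-based). -/
def w0Perm (n : ℕ) : Equiv.Perm (Fin n) where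
  toFun a := ⟨n - 1 - (a : ℕ), by have := a.isLt; omega⟩
  invFun a := ⟨n - 1 - (a : ℕ), by have := a.isLt; omega⟩
  left_inv a := by
    have := a.isLt
    apply Fin.ext
    show n - 1 - (n - 1 - (a : ℕ)) = (a : ℕ)
    omega
  right_inv a := by
    have := a.isLt
    apply Fin.ext
    show n - 1 - (n - 1 - (a : ℕ)) = (a : ℕ)
    omega

/-- Apply a permutation of `Fin n` to a 1-based label in {1, …, n}. -/
def permApp {n : ℕ} (σ : Equiv.Perm (Fin n)) (x : ℕ) : ℕ :=
  if h : 1 ≤ x ∧ x ≤ n then ((σ ⟨x - 1, by omega⟩ : Fin n) : ℕ) + 1 else x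

section NegWord

variable {𝕂 : Type*} [Field 𝕂]

/-- The action of `xNegMat n 𝕂 i z` on vectors, extended to sequences indexed by `ℕ`. -/
def negStep (i : ℕ) (z : 𝕂) (f : ℕ → 𝕂) : ℕ → 𝕂 := fun a =>
  if a + 1 = i then z⁻¹ * f a else if a = i then f (a - 1) + z * f a else f a

/-- The action on sequences of the product of the `xNegMat n 𝕂 i (z t)` along a word,
with `t` the 1-based position of `i` in the word. -/
def wordAct : List ℕ → (ℕ → 𝕂) → (ℕ → 𝕂) → ℕ → 𝕂
  | [], _, f => f
  | i :: w, z, f => negStep i (z 1) (wordAct w (fun t => z (t + 1)) f)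

theorem xNegMat_mulVec {n i : ℕ} (hi : 1 ≤ i) (hin : i < n) (z : 𝕂) (f : ℕ → 𝕂) :
    xNegMat n 𝕂 i z *ᵥ (fun a : Fin n => f a) = fun a : Fin n => negStep i z f a := by
  ext a
  simp only [mulVec, dotProduct, negStep]
  have ha := a.isLt
  split_ifs with h1 h2
  · rw [Fintype.sum_eq_single a]
    · simp [xNegMat, h1]
    · intro b hb
      have hb' : (b : ℕ) ≠ a := fun h => hb (Fin.ext h)
      simp only [xNegMat]
      rw [if_neg (by omega), if_neg (by omega), if_neg (by omega), if_neg (Ne.symm hb), zero_mul]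
  · have hlt : (a : ℕ) - 1 < n := by omega
    rw [Fintype.sum_eq_add (⟨a - 1, hlt⟩ : Fin n) a]
    · simp only [xNegMat]
      rw [if_neg (by omega), if_neg (by omega), if_pos (by omega), if_neg (by omega),
        if_pos (by omega), one_mul]
    · intro h
      have := congrArg Fin.val h
      simp only at this
      omega
    · rintro b ⟨hb1, hb2⟩
      have hb' : (b : ℕ) ≠ a := fun h => hb2 (Fin.ext h)
      have hb'' : (b : ℕ) ≠ a - 1 := fun h => hb1 (Fin.ext h)
      simp only [xNegMat]
      rw [if_neg (by omega), if_neg (by omega), if_neg (by omega), if_neg (Ne.symm hb2), zero_mul]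
  · rw [Fintype.sum_eq_single a]
    · simp [xNegMat, h1, h2]
    · intro b hb
      simp only [xNegMat]
      rw [if_neg (by omega), if_neg (by omega), if_neg (by omega), if_neg (Ne.symm hb), zero_mul]

theorem xNegMat_prod_mulVec {n : ℕ} (f : ℕ → 𝕂) : ∀ (w : List ℕ) (z : ℕ → 𝕂),
    (∀ i ∈ w, 1 ≤ i ∧ i < n) →
    ((List.range w.length).map (fun t => xNegMat n 𝕂 (w.getD t 0) (z (t + 1)))).prod *ᵥ
      (fun a : Fin n => f a) = fun a : Fin n => wordAct w z f a
  | [], _, _ => by simp [wordAct]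
  | i :: w, z, hw => by
    have ih := xNegMat_prod_mulVec f w (fun t => z (t + 1)) (fun i hi => hw i (by simp [hi]))
    have hi := hw i (by simp)
    rw [List.length_cons, List.range_succ_eq_map, List.map_cons, List.prod_cons, List.map_map,
      ← mulVec_mulVec]
    simp only [Function.comp_def, List.getD_cons_succ, List.getD_cons_zero, Nat.succ_eq_add_one,
      zero_add] at ih ⊢
    rw [ih, xNegMat_mulVec hi.1 hi.2]
    rfl

theorem wordAct_append (f : ℕ → 𝕂) : ∀ (w w' : List ℕ) (z : ℕ → 𝕂),
    wordAct (w ++ w') z f = wordAct w z (wordAct w' (fun t => z (w.length + t)) f)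
  | [], w', z => by simp [wordAct]
  | i :: w, w', z => by
    have ih := wordAct_append f w w' (fun t => z (t + 1))
    have h : (fun t => z ((i :: w).length + t)) = fun t => z (w.length + t + 1) := by
      funext t; congr 1; simp only [List.length_cons]; omega
    simp only [List.cons_append, wordAct, ih, h]

theorem wordAct_apply_of_lt (f : ℕ → 𝕂) (a : ℕ) : ∀ (w : List ℕ) (z : ℕ → 𝕂),
    (∀ i ∈ w, i < a) → wordAct w z f a = f a
  | [], _, _ => rfl
  | i :: w, z, hw => by
    have hi := hw i (by simp)
    rw [wordAct, negStep, if_neg (by omega), if_neg (by omega)]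
    exact wordAct_apply_of_lt f a w _ (fun i hi => hw i (by simp [hi]))

/-- The diagonal entry in row `a` (0-based) of `x_{-1}(z 1) ⋯ x_{-m}(z m)`. -/
def runDiag (m : ℕ) (z : ℕ → 𝕂) (a : ℕ) : 𝕂 :=
  (if a = 0 then 1 else if a ≤ m then z a else 1) / (if a + 1 ≤ m then z (a + 1) else 1)

theorem wordAct_block (m : ℕ) (z f : ℕ → 𝕂) (a : ℕ) :
    wordAct ((List.range m).map (· + 1)) z f a =
      runDiag m z a * f a + if 1 ≤ a ∧ a ≤ m then f (a - 1) else 0 := by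
  induction m generalizing f with
  | zero =>
    by_cases h : a = 0
    · simp [wordAct, runDiag, h]
    · simp [wordAct, runDiag, h]
  | succ m ih =>
    rw [List.range_succ, List.map_append, wordAct_append, ih]
    simp only [List.map_cons, List.map_nil, wordAct, negStep, List.length_map, List.length_range,
      runDiag]
    rcases lt_trichotomy a m with h | rfl | h
    · rw [if_neg (show ¬ a + 1 = m + 1 by omega), if_neg (show ¬ a = m + 1 by omega),
        if_neg (show ¬ a - 1 + 1 = m + 1 by omega), if_neg (show ¬ a - 1 = m + 1 by omega),
        if_pos (show a ≤ m by omega), if_pos (show a ≤ m + 1 by omega),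
        if_pos (show a + 1 ≤ m by omega), if_pos (show a + 1 ≤ m + 1 by omega)]
      simp only [show (1 ≤ a ∧ a ≤ m) ↔ (1 ≤ a ∧ a ≤ m + 1) by omega]
    · rw [if_pos (show a + 1 = a + 1 by omega),
        if_neg (show ¬ a - 1 = a + 1 by omega),
        if_pos (show a ≤ a by omega), if_pos (show a ≤ a + 1 by omega),
        if_neg (show ¬ a + 1 ≤ a by omega), if_pos (show a + 1 ≤ a + 1 by omega)]
      rcases Nat.eq_zero_or_pos a with rfl | h0
      · simp
      · rw [if_neg (show ¬ a - 1 + 1 = a + 1 by omega), if_neg (by omega), if_pos (by omega),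
          if_pos (by omega)]
        ring
    · rw [if_neg (show ¬ a + 1 = m + 1 by omega), if_neg (show ¬ a = 0 by omega),
        if_neg (show ¬ a ≤ m by omega), if_neg (show ¬ a + 1 ≤ m by omega),
        if_neg (show ¬ (1 ≤ a ∧ a ≤ m) by omega), if_neg (show ¬ a + 1 ≤ m + 1 by omega),
        if_neg (show ¬ a = 0 by omega)]
      by_cases h2 : a = m + 1
      · subst h2
        simp [add_comm]
      · rw [if_neg h2, if_neg (by omega), if_neg (by omega)]

theorem wordI0_succ_succ (m : ℕ) :
    wordI0 (m + 2) = (List.range (m + 1)).map (· + 1) ++ wordI0 (m + 1) := by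
  simp only [wordI0]
  rw [show m + 2 - 1 = m + 1 by omega, show m + 1 - 1 = m by omega, List.range_succ_eq_map,
    List.flatMap_cons, List.flatMap_map]
  simp only [Nat.sub_zero, ← List.range_succ_eq_map]
  congr 2
  funext k
  rw [Nat.succ_eq_add_one, Nat.add_sub_add_right]

theorem mem_wordI0 {n i : ℕ} (h : i ∈ wordI0 n) : 1 ≤ i ∧ i < n := by
  simp only [wordI0, List.mem_flatMap, List.mem_map, List.mem_range] at h
  obtain ⟨k, hk, a, ha, rfl⟩ := h
  omega

theorem length_wordI0 (n : ℕ) : (wordI0 n).length = n * (n - 1) / 2 := by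
  suffices h : ∀ m : ℕ, 2 * (wordI0 (m + 1)).length = (m + 1) * m by
    rcases n with _ | m
    · simp [wordI0]
    · have := h m
      rw [Nat.add_sub_cancel]
      omega
  intro m
  induction m with
  | zero => simp [wordI0]
  | succ m ih =>
    rw [wordI0_succ_succ, List.length_append, List.length_map, List.length_range, mul_add, ih]
    ring

theorem wordAct_wordI0_succ_succ (m : ℕ) (z f : ℕ → 𝕂) (a : ℕ) :
    wordAct (wordI0 (m + 2)) z f a =
      runDiag (m + 1) z a * wordAct (wordI0 (m + 1)) (fun t => z (m + 1 + t)) f a +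
        if 1 ≤ a ∧ a ≤ m + 1 then
          wordAct (wordI0 (m + 1)) (fun t => z (m + 1 + t)) f (a - 1) else 0 := by
  rw [wordI0_succ_succ, wordAct_append, wordAct_block]
  simp

/-- The corner entries of the reduction of the product along `wordI0 (m + 1)`
to anti-triangular form are the signs of `w0bar`. -/
theorem wordAct_wordI0_corner (m : ℕ) (z y : ℕ → 𝕂) (j : ℕ)
    (hz : ∀ t, 1 ≤ t → t ≤ (wordI0 (m + 1)).length → z t ≠ 0)
    (hj : j ≤ m) (hyj : y j = 1) (hy : ∀ i, j < i → y i = 0)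
    (h0 : ∀ i, m - j < i → i ≤ m → wordAct (wordI0 (m + 1)) z y i = 0) :
    wordAct (wordI0 (m + 1)) z y (m - j) = (-1) ^ j := by
  induction m generalizing z with
  | zero =>
    obtain rfl : j = 0 := by omega
    simpa [wordI0, wordAct] using hyj
  | succ m ih =>
    have hlen : (wordI0 (m + 2)).length = m + 1 + (wordI0 (m + 1)).length := by
      rw [wordI0_succ_succ]; simp
    rw [show m + 1 + 1 = m + 2 from rfl] at *
    set g := wordAct (wordI0 (m + 1)) (fun t => z (m + 1 + t)) y with hg
    have hgtop : g (m + 1) = y (m + 1) :=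
      wordAct_apply_of_lt _ _ _ _ (fun i hi => (mem_wordI0 hi).2)
    have hrec : ∀ i, 1 ≤ i → i ≤ m + 1 → wordAct (wordI0 (m + 2)) z y i =
        runDiag (m + 1) z i * g i + g (i - 1) := by
      intro i h1 h2
      rw [wordAct_wordI0_succ_succ, if_pos ⟨h1, h2⟩]
    rcases Nat.lt_or_ge m j with hjm | hjm
    · obtain rfl : j = m + 1 := by omega
      have key : ∀ t, t ≤ m → g (m - t) = (-1) ^ (t + 1) * z (m - t + 1) := by
        intro t
        induction t with
        | zero =>
          intro _
          have h := hrec (m + 1) (by omega) le_rfl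
          rw [h0 _ (by omega) le_rfl, hgtop, hyj] at h
          simp [runDiag] at h
          simp only [Nat.sub_zero, zero_add, pow_one]
          linear_combination -h
        | succ t iht =>
          intro ht
          have h := hrec (m - t) (by omega) (by omega)
          rw [h0 _ (by omega) (by omega), iht (by omega), runDiag, if_neg (by omega),
            if_pos (by omega), if_pos (by omega)] at h
          rw [show m - (t + 1) = m - t - 1 by omega, show m - t - 1 + 1 = m - t by omega]
          have hne := hz (m - t + 1) (by omega) (by omega)
          field_simp at h
          rw [pow_succ _ (t + 1)]
          linear_combination -h
      have h := key m le_rfl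
      rw [Nat.sub_self, zero_add] at h
      have hne := hz 1 le_rfl (by omega)
      rw [Nat.sub_self, wordAct_wordI0_succ_succ, ← hg, h, runDiag]
      simp
      field_simp
    · have key : ∀ t, m - j < m + 1 - t → g (m + 1 - t) = 0 := by
        intro t
        induction t with
        | zero => intro _; rw [Nat.sub_zero, hgtop]; exact hy _ (by omega)
        | succ t iht =>
          intro ht
          have h := hrec (m + 1 - t) (by omega) (by omega)
          rw [h0 _ (by omega) (by omega), iht (by omega), mul_zero, zero_add] at h
          rw [show m + 1 - (t + 1) = m + 1 - t - 1 by omega, ← h]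
      rw [hrec _ (by omega) (by omega), key j (by omega), mul_zero, zero_add,
        show m + 1 - j - 1 = m - j by omega]
      refine ih _ (fun t h1 h2 => hz _ (by omega) (by omega)) hjm (fun i h1 h2 => ?_)
      have := key (m + 1 - i) (by omega)
      rwa [show m + 1 - (m + 1 - i) = i by omega] at this

theorem sIdx_one (n : ℕ) : sIdx n 1 = 0 := by simp [sIdx]

theorem sIdx_succ_succ (m k : ℕ) : sIdx (m + 1) (k + 2) = m + sIdx m (k + 1) := by
  simp only [sIdx]
  rw [show k + 2 - 1 = k + 1 by omega, show k + 1 - 1 = k by omega]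
  induction k with
  | zero => simp
  | succ k ih =>
    rw [Finset.sum_Icc_succ_top (by omega), ih, Finset.sum_Icc_succ_top (by omega)]
    omega

theorem wordAct_wordI0_diag (m : ℕ) (z f : ℕ → 𝕂) (j : ℕ) (hf : ∀ i, i < j → f i = 0) :
    (∀ i, i < j → wordAct (wordI0 (m + 1)) z f i = 0) ∧
    wordAct (wordI0 (m + 1)) z f j =
      (∏ l ∈ Finset.range m, runDiag (m - l) (fun a => z (sIdx (m + 1) (l + 1) + a)) j) *
        f j := by
  induction m generalizing z with
  | zero => simpa [wordI0, wordAct] using hf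
  | succ m ih =>
    obtain ⟨ih0, ihj⟩ := ih (fun t => z (m + 1 + t))
    constructor
    · intro i hi
      rw [wordAct_wordI0_succ_succ, ih0 i hi, ih0 (i - 1) (by omega)]
      simp
    · rw [wordAct_wordI0_succ_succ, ihj, Finset.prod_range_succ']
      have hs : ∀ l, sIdx (m + 1 + 1) (l + 1 + 1) = m + 1 + sIdx (m + 1) (l + 1) :=
        sIdx_succ_succ (m + 1)
      have h0 : (if 1 ≤ j ∧ j ≤ m + 1 then
          wordAct (wordI0 (m + 1)) (fun t => z (m + 1 + t)) f (j - 1) else 0) = 0 := by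
        split_ifs with h
        · exact ih0 _ (by omega)
        · rfl
      rw [h0]
      simp only [hs, sIdx_one, zero_add, Nat.sub_zero, Nat.add_sub_add_right, add_assoc (m + 1)]
      ring

theorem sIdx_add_le_length_wordI0 (m l a : ℕ) (hl : l ≤ m) (ha : a ≤ m - l) :
    sIdx (m + 1) (l + 1) + a ≤ (wordI0 (m + 1)).length := by
  induction m generalizing l with
  | zero =>
    obtain rfl : l = 0 := by omega
    obtain rfl : a = 0 := by omega
    simp [sIdx_one]
  | succ m ih =>
    rw [wordI0_succ_succ, List.length_append, List.length_map, List.length_range]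
    rcases l with _ | l
    · rw [zero_add, sIdx_one]
      omega
    · have := ih l (by omega) (by omega)
      rw [sIdx_succ_succ]
      omega

theorem prod_Icc_div_pred (f : ℕ → 𝕂) (j : ℕ) (h0 : f 0 = 1) (hf : ∀ i, i ≤ j → f i ≠ 0) :
    ∏ k ∈ Finset.Icc 1 j, f k / f (k - 1) = f j := by
  induction j with
  | zero => simp [h0]
  | succ j ih =>
    rw [Finset.prod_Icc_succ_top (by omega), ih (fun i hi => hf i (by omega)),
      Nat.add_sub_cancel, mul_div_cancel₀ _ (hf j (by omega))]

theorem prod_Icc_reflect (f : ℕ → 𝕂) (p : ℕ) :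
    ∏ r ∈ Finset.Icc 1 p, f (p - r) = ∏ l ∈ Finset.range p, f l := by
  rw [← Finset.prod_range_reflect, Finset.range_eq_Ico,
    Finset.prod_Ico_eq_prod_range, ← Finset.Ico_add_one_right_eq_Icc,
    Finset.prod_Ico_eq_prod_range]
  refine Finset.prod_congr (by simp) (fun r _ => ?_)
  congr 1
  omega

theorem prod_runDiag (m : ℕ) (z : ℕ → 𝕂) (j : ℕ) (hj : j ≤ m) (g : ℕ → ℕ → 𝕂)
    (hg : ∀ l a, g l a = if a = 0 then 1 else z (sIdx (m + 1) l + a)) :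
    ∏ l ∈ Finset.range m, runDiag (m - l) (fun a => z (sIdx (m + 1) (l + 1) + a)) j =
      (∏ l ∈ Finset.range (m - j + 1), g (l + 1) j) /
        ∏ l ∈ Finset.range (m - j), g (l + 1) (j + 1) := by
  simp only [runDiag]
  rw [Finset.prod_div_distrib]
  congr 1
  · rcases Nat.eq_zero_or_pos j with rfl | h0
    · simp [hg]
    · rw [← Finset.prod_subset (Finset.range_mono (show m - j + 1 ≤ m by omega))]
      · refine Finset.prod_congr rfl (fun l hl => ?_)
        rw [Finset.mem_range] at hl
        rw [if_neg (by omega), if_pos (by omega), hg, if_neg (by omega)]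
      · intro l _ hl
        rw [Finset.mem_range] at hl
        rw [if_neg (by omega), if_neg (by omega)]
  · rw [← Finset.prod_subset (Finset.range_mono (show m - j ≤ m by omega))]
    · refine Finset.prod_congr rfl (fun l hl => ?_)
      rw [Finset.mem_range] at hl
      rw [if_pos (by omega), hg, if_neg (by omega)]
    · intro l _ hl
      rw [Finset.mem_range] at hl
      rw [if_neg (by omega)]

theorem w0bar_apply (n : ℕ) (a b : Fin n) :
    w0bar n 𝕂 a b = if b = a.rev then (-1 : 𝕂) ^ (a.rev : ℕ) else 0 := by
  have h : (a : ℕ) + b = n - 1 ↔ b = a.rev := by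
    rw [Fin.ext_iff, Fin.val_rev]
    omega
  simp only [w0bar, h, Fin.val_rev]
  split_ifs
  · congr 1
    omega
  · rfl

theorem w0bar_mul_apply {n : ℕ} (M : Matrix (Fin n) (Fin n) 𝕂) (a b : Fin n) :
    (w0bar n 𝕂 * M) a b = (-1) ^ (a.rev : ℕ) * M a.rev b := by
  simp [mul_apply, w0bar_apply]

theorem mul_w0bar_apply {n : ℕ} (M : Matrix (Fin n) (Fin n) 𝕂) (a b : Fin n) :
    (M * w0bar n 𝕂) a b = M a b.rev * (-1) ^ (b : ℕ) := by
  rw [mul_apply, Finset.sum_eq_single b.rev]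
  · simp [w0bar_apply]
  · intro c _ hc
    rw [w0bar_apply, if_neg, mul_zero]
    rintro rfl
    exact hc (Fin.rev_rev c).symm
  · simp

theorem mul_w0bar_transpose_apply {n : ℕ} (M : Matrix (Fin n) (Fin n) 𝕂) (a b : Fin n) :
    (M * (w0bar n 𝕂)ᵀ) a b = M a b.rev * (-1) ^ (b.rev : ℕ) := by
  rw [← transpose_transpose M, ← transpose_mul, transpose_apply, w0bar_mul_apply, mul_comm]
  rfl

theorem w0bar_mul_transpose (n : ℕ) : w0bar n 𝕂 * (w0bar n 𝕂)ᵀ = 1 := by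
  ext a b
  rw [mul_w0bar_transpose_apply, w0bar_apply, one_apply]
  by_cases h : a = b
  · subst h
    simp [← mul_pow]
  · rw [if_neg (fun h' => h (Fin.rev_injective h').symm), if_neg h, zero_mul]

theorem w0bar_eq_smul_transpose (n : ℕ) :
    w0bar n 𝕂 = (-1 : 𝕂) ^ (n - 1) • (w0bar n 𝕂)ᵀ := by
  ext a b
  rw [Matrix.smul_apply, transpose_apply, w0bar_apply, w0bar_apply, smul_eq_mul]
  by_cases h : b = a.rev
  · subst h
    rw [if_pos rfl, Fin.rev_rev, if_pos rfl, ← pow_add, Fin.val_rev]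
    rw [show n - 1 + (a : ℕ) = (n - (a + 1)) + 2 * a by omega, pow_add _ _ (2 * (a : ℕ)), pow_mul]
    simp
  · rw [if_neg h, if_neg (fun h' => h (by rw [h', Fin.rev_rev])), mul_zero]

theorem mul_apply_of_upper {n : ℕ} (P Q : Matrix (Fin n) (Fin n) 𝕂) (a b : Fin n)
    (hP : ∀ c, c < a → P a c = 0) (hQ : ∀ c, a < c → Q c b = 0) :
    (P * Q) a b = P a a * Q a b := by
  rw [mul_apply, Finset.sum_eq_single a]
  · intro c _ hc
    rcases lt_or_gt_of_ne hc with h | h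
    · rw [hP c h, zero_mul]
    · rw [hQ c h, mul_zero]
  · simp

theorem det_of_unit_upper {n : ℕ} {P : Matrix (Fin n) (Fin n) 𝕂}
    (hP : ∀ a b, b < a → P a b = 0) (hP1 : ∀ a, P a a = 1) : P.det = 1 := by
  rw [det_of_isUpperTriangular (fun a b h => hP a b h)]
  simp [hP1]

theorem inv_unit_upper {n : ℕ} {P : Matrix (Fin n) (Fin n) 𝕂}
    (hP : ∀ a b, b < a → P a b = 0) (hP1 : ∀ a, P a a = 1) :
    (∀ a b, b < a → P⁻¹ a b = 0) ∧ ∀ a, P⁻¹ a a = 1 := by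
  have hdet : IsUnit P.det := by rw [det_of_unit_upper hP hP1]; exact isUnit_one
  have := P.invertibleOfIsUnitDet hdet
  have htri : P⁻¹.BlockTriangular id :=
    blockTriangular_inv_of_blockTriangular (fun a b h => hP a b h)
  have h0 : ∀ a b, b < a → P⁻¹ a b = 0 := fun a b h => htri h
  refine ⟨h0, fun a => ?_⟩
  have h := congrFun (congrFun (P.nonsing_inv_mul hdet) a) a
  rwa [mul_apply_of_upper _ _ _ _ (fun c hc => h0 a c hc) (fun c hc => hP c a hc), hP1, mul_one,
    one_apply_eq] at h

/-- The product of the `xNegMat` along `wordI0 n` has Bruhat decomposition `K * w0bar * u₁` with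
`K` and `u₁` unipotent upper triangular, read off from the Gauss decomposition. -/
theorem bruhat_of_gauss {n : ℕ} (hn : 1 ≤ n) (z : ℕ → 𝕂)
    (hz : ∀ t, 1 ≤ t → t ≤ (wordI0 n).length → z t ≠ 0)
    (u L D U : Matrix (Fin n) (Fin n) 𝕂)
    (hu : ∀ f : ℕ → 𝕂, u *ᵥ (fun a : Fin n => f a) = fun a : Fin n => wordAct (wordI0 n) z f a)
    (hL : ∀ a b : Fin n, a < b → L a b = 0) (hLdiag : ∀ a : Fin n, L a a = 1)
    (hD : ∀ a b : Fin n, a ≠ b → D a b = 0) (hDinv : ∀ a : Fin n, D a a ≠ 0)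
    (hU : ∀ a b : Fin n, b < a → U a b = 0) (hUdiag : ∀ a : Fin n, U a a = 1)
    (hLDU : (w0bar n 𝕂 * uᵀ)⁻¹ = L * D * U) :
    u = (Lᵀ)⁻¹ * w0bar n 𝕂 * (w0bar n 𝕂 * U⁻¹ * (w0bar n 𝕂)⁻¹)ᵀ := by
  have hWW := w0bar_mul_transpose (𝕂 := 𝕂) n
  have hWW' := mul_eq_one_comm.mp hWW
  have hWs := w0bar_eq_smul_transpose (𝕂 := 𝕂) n
  have hWinv : (w0bar n 𝕂)⁻¹ = (w0bar n 𝕂)ᵀ := inv_eq_right_inv hWW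
  have hDd : D = diagonal (fun a => D a a) := by
    ext a b
    by_cases h : a = b
    · subst h; simp
    · rw [hD a b h, diagonal_apply_ne _ h]
  have hLT : ∀ a b : Fin n, b < a → Lᵀ a b = 0 := fun a b h => hL b a h
  have hLdet : L.det = 1 := by rw [← det_transpose]; exact det_of_unit_upper hLT hLdiag
  have hUdet : U.det = 1 := det_of_unit_upper hU hUdiag
  obtain ⟨hK, hK1⟩ := inv_unit_upper hLT hLdiag
  have hDinv' : D⁻¹ = diagonal (fun a => (D a a)⁻¹) := by
    refine inv_eq_right_inv ?_
    rw [hDd]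
    simp [hDinv]
  set W := w0bar n 𝕂 with hW
  have hdet : IsUnit (W * uᵀ).det := by
    rw [← isUnit_nonsing_inv_det_iff, hLDU, det_mul, det_mul, hLdet, hUdet, hDd, det_diagonal]
    simpa [isUnit_iff_ne_zero, Finset.prod_ne_zero_iff] using hDinv
  have hWu : W * uᵀ = U⁻¹ * (D⁻¹ * L⁻¹) := by
    rw [← nonsing_inv_nonsing_inv _ hdet, hLDU, Matrix.mul_inv_rev, Matrix.mul_inv_rev]
  have hDT : (D⁻¹)ᵀ = D⁻¹ := by rw [hDinv', diagonal_transpose]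
  have hu' : u = (Lᵀ)⁻¹ * D⁻¹ * (U⁻¹)ᵀ * W := by
    have h : uᵀ = Wᵀ * (U⁻¹ * (D⁻¹ * L⁻¹)) := by
      rw [← hWu, ← mul_assoc, hWW', one_mul]
    rw [← transpose_transpose u, h]
    simp only [transpose_mul, transpose_transpose, hDT, transpose_nonsing_inv]
  have hW2 : W * W = (-1 : 𝕂) ^ (n - 1) • 1 := by
    rw [← hWW', ← smul_mul_assoc, ← hWs]
  have hu₁ : W * (W * U⁻¹ * W⁻¹)ᵀ = (U⁻¹)ᵀ * W := by
    simp only [hWinv, transpose_mul, transpose_transpose]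
    rw [← mul_assoc, hW2, smul_mul_assoc, one_mul, ← mul_smul_comm, ← hWs]
  have hY : u * (W * Uᵀ * Wᵀ) = (Lᵀ)⁻¹ * D⁻¹ * W := by
    have hU1 : (U⁻¹)ᵀ * Uᵀ = 1 := by
      rw [← transpose_mul, mul_nonsing_inv _ (by rw [hUdet]; exact isUnit_one), transpose_one]
    calc u * (W * Uᵀ * Wᵀ) = (Lᵀ)⁻¹ * D⁻¹ * ((U⁻¹)ᵀ * (W * W) * Uᵀ * Wᵀ) := by
          conv_lhs => rw [hu']
          simp only [mul_assoc]
      _ = (Lᵀ)⁻¹ * D⁻¹ * W := by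
          rw [hW2, mul_smul_comm, mul_one, smul_mul_assoc, hU1, smul_mul_assoc, one_mul, ← hWs]
  obtain ⟨m, rfl⟩ : ∃ m, n = m + 1 := ⟨n - 1, by omega⟩
  have hrow : ∀ i j : Fin (m + 1), ((Lᵀ)⁻¹ * D⁻¹ * W) i j =
      (Lᵀ)⁻¹ i j.rev * (D j.rev j.rev)⁻¹ * (-1) ^ (j : ℕ) := by
    intro i j
    rw [hW, mul_w0bar_apply, hDinv', mul_diagonal]
  have hD1 : ∀ j : Fin (m + 1), (D j.rev j.rev)⁻¹ = 1 := by
    intro j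
    set Y := W * Uᵀ * Wᵀ with hYdef
    have hYent : ∀ a b, Y a b = (-1) ^ (a.rev : ℕ) * U b.rev a.rev * (-1) ^ (b.rev : ℕ) := by
      intro a b
      rw [hYdef, hW, mul_w0bar_transpose_apply, w0bar_mul_apply, transpose_apply]
    set y : ℕ → 𝕂 := fun i => if h : i < m + 1 then Y ⟨i, h⟩ j else 0 with hy
    have hyY : ∀ a : Fin (m + 1), y a = Y a j := fun a => dif_pos a.isLt
    have huY : ∀ i : Fin (m + 1), wordAct (wordI0 (m + 1)) z y i =
        (Lᵀ)⁻¹ i j.rev * (D j.rev j.rev)⁻¹ * (-1) ^ (j : ℕ) := by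
      intro i
      rw [← hrow, ← hY, ← congrFun (hu y) i]
      simp only [mul_apply, mulVec, dotProduct, hyY]
    have hj := j.isLt
    have h := wordAct_wordI0_corner m z y j hz (by omega) ?_ ?_ ?_
    · have h' := huY j.rev
      rw [Fin.val_rev, show m + 1 - ((j : ℕ) + 1) = m - j by omega, h, hK1, one_mul] at h'
      exact (mul_eq_right₀ (pow_ne_zero _ (by simp))).mp h'.symm
    · rw [hyY, hYent, hUdiag, mul_one, ← mul_pow]
      simp
    · intro i hi
      simp only [hy]
      split_ifs with h
      · rw [hYent, hU, mul_zero, zero_mul]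
        rw [Fin.rev_lt_rev]
        exact hi
      · rfl
    · intro i h1 h2
      have h' := huY ⟨i, by omega⟩
      rw [hK _ _ (by rw [Fin.lt_def, Fin.val_rev]; simp only; omega), zero_mul, zero_mul] at h'
      exact h'
  have hDone : D⁻¹ = 1 := by
    rw [hDinv', ← diagonal_one]
    congr 1
    funext a
    simpa using hD1 a.rev
  rw [mul_assoc, hu₁, ← mul_assoc]
  rw [hDone, mul_one] at hu'
  exact hu'

theorem diag_of_bruhat {n : ℕ} (K u u₁ d u₂ b : Matrix (Fin n) (Fin n) 𝕂)
    (hK : ∀ a b : Fin n, b < a → K a b = 0) (hK1 : ∀ a, K a a = 1)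
    (hu : ∀ a b : Fin n, a < b → u a b = 0) (hd : ∀ a b : Fin n, a ≠ b → d a b = 0)
    (hu₂ : ∀ a b : Fin n, b < a → u₂ a b = 0) (hu₂diag : ∀ a : Fin n, u₂ a a = 1)
    (hblower : ∀ p q : Fin n, p < q → b p q = 0)
    (huK : u = K * w0bar n 𝕂 * u₁) (hb : b = u₁ * d * w0bar n 𝕂 * u₂) (j : Fin n) :
    b j.rev j.rev = u j j * d j j := by
  have hdd : d = diagonal (fun a => d a a) := by
    ext a b
    by_cases h : a = b
    · subst h; simp
    · rw [hd a b h, diagonal_apply_ne _ h]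
  have hX : ∀ x, (u * d * w0bar n 𝕂) j x = u j x.rev * d x.rev x.rev * (-1) ^ (x : ℕ) := by
    intro x
    rw [mul_w0bar_apply, hdd, mul_diagonal]
    simp
  have h : K * (w0bar n 𝕂 * b) = u * d * w0bar n 𝕂 * u₂ := by
    rw [hb, huK]
    simp only [mul_assoc]
  have h1 := congrFun (congrFun h j) j.rev
  rw [mul_apply_of_upper _ _ _ _ (fun c hc => hK j c hc), hK1, one_mul, w0bar_mul_apply,
    mul_apply, Finset.sum_eq_single j.rev, hX, hu₂diag, Fin.rev_rev, mul_one, mul_comm] at h1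
  · exact mul_right_cancel₀ (pow_ne_zero _ (by simp)) h1
  · intro x _ hx
    rcases lt_or_gt_of_ne hx with h' | h'
    · rw [hX, hu j x.rev (by rwa [← Fin.rev_lt_rev, Fin.rev_rev]), zero_mul, zero_mul, zero_mul]
    · rw [hu₂ _ _ h', mul_zero]
  · simp
  · intro c hc
    rw [w0bar_mul_apply, hblower _ _ (Fin.rev_lt_rev.mpr hc), mul_zero]

end NegWord

/-- with the ideal coordinates m defined from the string coordinates z,
the diagonal entries of b satisfy
b_{n+1−j,n+1−j} = d_{jj} · (∏_{k=1}^{j−1} m_{s_k+(j−k)}) / (∏_{r=1}^{n−j} m_{s_j+r}). -/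
theorem stmt6
    (𝕂 : Type*) [Field 𝕂]
    (n N : ℕ) (hn : 2 ≤ n) (hN : N = n * (n - 1) / 2)
    (z : ℕ → 𝕂) (hz : ∀ j, 1 ≤ j → j ≤ N → z j ≠ 0)
    (u : Matrix (Fin n) (Fin n) 𝕂)
    (hu : u = ((List.range N).map
      (fun t => xNegMat n 𝕂 ((wordI0 n).getD t 0) (z (t + 1)))).prod)
    (L D U : Matrix (Fin n) (Fin n) 𝕂)
    (hL : ∀ a b : Fin n, a < b → L a b = 0) (hLdiag : ∀ a : Fin n, L a a = 1)
    (hD : ∀ a b : Fin n, a ≠ b → D a b = 0) (hDinv : ∀ a : Fin n, D a a ≠ 0)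
    (hU : ∀ a b : Fin n, b < a → U a b = 0) (hUdiag : ∀ a : Fin n, U a a = 1)
    (hLDU : (w0bar n 𝕂 * u.transpose)⁻¹ = L * D * U)
    (u₁ : Matrix (Fin n) (Fin n) 𝕂)
    (hu₁ : u₁ = (w0bar n 𝕂 * U⁻¹ * (w0bar n 𝕂)⁻¹).transpose)
    (d : Matrix (Fin n) (Fin n) 𝕂)
    (hd : ∀ a b : Fin n, a ≠ b → d a b = 0) (hdinv : ∀ a : Fin n, d a a ≠ 0)
    (u₂ : Matrix (Fin n) (Fin n) 𝕂)
    (hu₂ : ∀ a b : Fin n, b < a → u₂ a b = 0) (hu₂diag : ∀ a : Fin n, u₂ a a = 1)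
    (b : Matrix (Fin n) (Fin n) 𝕂)
    (hb : b = u₁ * d * w0bar n 𝕂 * u₂)
    (hblower : ∀ p q : Fin n, p < q → b p q = 0)
    (m : ℕ → 𝕂)
    (hm : ∀ k a, 1 ≤ k → k ≤ n - 1 → 1 ≤ a → a ≤ n - k →
      m (sIdx n k + a) =
        if k = 1 then z (1 + sIdx n (n - a))
        else z (k + sIdx n (n - k - a + 1)) / z (k - 1 + sIdx n (n - k - a + 1))) :
    ∀ j : Fin n, b j.rev j.rev =
      d j j *
        (∏ k ∈ Finset.Icc 1 (j : ℕ), m (sIdx n k + ((j : ℕ) + 1 - k))) /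
        (∏ r ∈ Finset.Icc 1 (n - ((j : ℕ) + 1)), m (sIdx n ((j : ℕ) + 1) + r)) := by

  obtain ⟨m', rfl⟩ : ∃ m', n = m' + 1 := ⟨n - 1, by omega⟩
  obtain rfl : N = (wordI0 (m' + 1)).length := by rw [hN, length_wordI0]
  have huact : ∀ f : ℕ → 𝕂, u *ᵥ (fun a : Fin (m' + 1) => f a) =
      fun a : Fin (m' + 1) => wordAct (wordI0 (m' + 1)) z f a := by
    intro f
    rw [hu]
    exact xNegMat_prod_mulVec f _ z (fun i hi => mem_wordI0 hi)
  have huK := bruhat_of_gauss (by omega) z hz u L D U huact hL hLdiag hD hDinv hU hUdiag hLDU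
  rw [← hu₁] at huK
  have hLT : ∀ a b : Fin (m' + 1), b < a → Lᵀ a b = 0 := fun a b h => hL b a h
  obtain ⟨hK, hK1⟩ := inv_unit_upper hLT hLdiag
  have hcol : ∀ a c : Fin (m' + 1), u a c =
      wordAct (wordI0 (m' + 1)) z (fun i => if i = c then 1 else 0) a := by
    intro a c
    rw [← congrFun (huact _) a]
    simp [mulVec, dotProduct, ← Fin.ext_iff]
  have hdiag := fun c : Fin (m' + 1) => wordAct_wordI0_diag m' z
    (fun i => if i = (c : ℕ) then 1 else 0) c (fun i hi => if_neg hi.ne)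
  have hulow : ∀ a c : Fin (m' + 1), a < c → u a c = 0 := by
    intro a c hac
    rw [hcol]
    exact (hdiag c).1 a hac
  intro j
  have hj := j.isLt
  set g : ℕ → ℕ → 𝕂 := fun l a => if a = 0 then 1 else z (sIdx (m' + 1) l + a) with hg
  have hmg : ∀ k a, 1 ≤ k → k ≤ m' → 1 ≤ a → a ≤ m' + 1 - k →
      m (sIdx (m' + 1) k + a) = g (m' + 1 - k - a + 1) k / g (m' + 1 - k - a + 1) (k - 1) := by
    intro k a h1 h2 h3 h4
    rw [hm k a h1 (by omega) h3 h4]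
    simp only [hg]
    split_ifs with h5 h6 h6
    · omega
    · omega
    · subst h5
      rw [div_one, add_comm 1 (sIdx _ _), show m' + 1 - a = m' + 1 - 1 - a + 1 by omega]
    · omega
    · omega
    · omega
    · omega
    · rw [add_comm k, add_comm (k - 1)]
  have hnum : ∏ k ∈ Finset.Icc 1 (j : ℕ), m (sIdx (m' + 1) k + ((j : ℕ) + 1 - k)) =
      g (m' - j + 1) j := by
    rw [← prod_Icc_div_pred (g (m' - j + 1)) j (by simp [hg])]
    · refine Finset.prod_congr rfl (fun k hk => ?_)
      rw [Finset.mem_Icc] at hk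
      rw [hmg k _ hk.1 (by omega) (by omega) (by omega),
        show m' + 1 - k - ((j : ℕ) + 1 - k) + 1 = m' - j + 1 by omega]
    · intro i hi
      simp only [hg]
      split_ifs with h0
      · exact one_ne_zero
      · exact hz _ (by omega) (sIdx_add_le_length_wordI0 _ _ _ (by omega) (by omega))
  have hden : ∏ r ∈ Finset.Icc 1 (m' + 1 - ((j : ℕ) + 1)), m (sIdx (m' + 1) ((j : ℕ) + 1) + r) =
      (∏ l ∈ Finset.range (m' - j), g (l + 1) (j + 1)) /
        ∏ l ∈ Finset.range (m' - j), g (l + 1) j := by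
    rw [← Finset.prod_div_distrib,
      ← prod_Icc_reflect (fun l => g (l + 1) ((j : ℕ) + 1) / g (l + 1) j),
      show m' + 1 - ((j : ℕ) + 1) = m' - j by omega]
    refine Finset.prod_congr rfl (fun r hr => ?_)
    rw [Finset.mem_Icc] at hr
    rw [hmg _ r (by omega) (by omega) (by omega) (by omega), Nat.add_sub_cancel,
      show m' + 1 - ((j : ℕ) + 1) - r + 1 = m' - j - r + 1 by omega]
  rw [diag_of_bruhat _ u u₁ d u₂ b hK hK1 hulow hd hu₂ hu₂diag hblower huK hb j, hcol,
    (hdiag j).2, if_pos rfl, mul_one, prod_runDiag m' z j (by omega) g (fun _ _ => rfl), hnum, hden,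
    Finset.prod_range_succ, div_div_eq_mul_div]
  ring
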